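/- Assume b_0 ≥ ν and let M be a matrix of full rank type. Then for every integer l ≥ 2: dim_ℂ (A/(J(l) + I_M))_{s_l} = #{i ∈ {1,…,ν} : ε_{i,(j,l−j)} = 1 for every integer j with 1 ≤ j ≤ l−1}. (That is, in the minimal rational case the number Q(l) of degree-l generators equals the number n_l of variables dividing every monomial of X_l.) -/

import Mathlib

open scoped BigOperators

/-- `s_l := l·b₀ − Σ_i ⌈l·ω_i/α_i⌉`. -/
noncomputable def sVal (ν : ℕ) (b0 : ℤ) (α ω : Fin ν → ℤ) (l : ℤ) : ℤ :=
  l * b0 - ∑ i, ⌈((l * ω i : ℤ) : ℚ) / (α i : ℚ)⌉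

/-- `ε_{i,(l₁,l₂)} := {l₁·β_i/α_i} + {l₂·β_i/α_i} − {(l₁+l₂)·β_i/α_i}`. -/
noncomputable def epsQ (ν : ℕ) (α β : Fin ν → ℤ) (i : Fin ν) (l₁ l₂ : ℤ) : ℚ :=
  Int.fract (((l₁ * β i : ℤ) : ℚ) / (α i : ℚ)) + Int.fract (((l₂ * β i : ℤ) : ℚ) / (α i : ℚ)) -
    Int.fract ((((l₁ + l₂) * β i : ℤ) : ℚ) / (α i : ℚ))

/-- The set of monomials `X_l := { ∏_i a_i^{ε_{i,(l₁,l₂)}} : (l₁,l₂) ∈ Λ_l }`. -/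
noncomputable def Xset (ν : ℕ) (b0 : ℤ) (α ω β : Fin ν → ℤ) (l : ℤ) :
    Set (MvPolynomial (Fin ν) ℂ) :=
  { p | ∃ l₁ l₂ : ℤ, 1 ≤ l₁ ∧ 1 ≤ l₂ ∧ l₁ + l₂ = l ∧
      0 ≤ sVal ν b0 α ω l₁ ∧ 0 ≤ sVal ν b0 α ω l₂ ∧
      p = ∏ i, MvPolynomial.X i ^ (if epsQ ν α β i l₁ l₂ = 1 then 1 else 0) }

/-- `J(l)`, the ideal of `A` generated by `X_l`. -/
noncomputable def Jl (ν : ℕ) (b0 : ℤ) (α ω β : Fin ν → ℤ) (l : ℤ) :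
    Ideal (MvPolynomial (Fin ν) ℂ) :=
  Ideal.span (Xset ν b0 α ω β l)

/-- The dimension of the degree-`k` homogeneous component of `A/K`:
`dim_ℂ A_k − dim_ℂ (K ∩ A_k)`. -/
noncomputable def hdim {ν : ℕ} (K : Ideal (MvPolynomial (Fin ν) ℂ)) (k : ℕ) : ℕ :=
  Module.finrank ℂ (MvPolynomial.homogeneousSubmodule (Fin ν) ℂ k) -
    Module.finrank ℂ
      (Submodule.restrictScalars ℂ K ⊓ MvPolynomial.homogeneousSubmodule (Fin ν) ℂ k :
        Submodule ℂ (MvPolynomial (Fin ν) ℂ))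

/-- A `(ν−2)×ν` complex matrix is of full rank type if every `(ν−2)×(ν−2)` minor is nonzero. -/
def FullRankType (ν : ℕ) (M : Matrix (Fin (ν - 2)) (Fin ν) ℂ) : Prop :=
  ∀ g : Fin (ν - 2) ↪ Fin ν, (M.submatrix id g).det ≠ 0

/-- The ideal `I_M` generated by the `ν−2` linear forms `ℓ_j = Σ_i M_{j,i}·a_i`. -/
noncomputable def IM {ν : ℕ} (M : Matrix (Fin (ν - 2)) (Fin ν) ℂ) :
    Ideal (MvPolynomial (Fin ν) ℂ) :=
  Ideal.span (Set.range fun j : Fin (ν - 2) =>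
    ∑ i, MvPolynomial.C (M j i) * MvPolynomial.X i)

open MvPolynomial

section LinearAlgebra

variable {ν : ℕ} {M : Matrix (Fin (ν - 2)) (Fin ν) ℂ}

/-- For two distinct columns, the remaining `ν - 2` columns can be enumerated. -/
theorem exists_embedding_range_eq_compl_pair {i j : Fin ν} (hij : i ≠ j) :
    ∃ g : Fin (ν - 2) ↪ Fin ν, ∀ t, t ∈ Set.range g ↔ t ≠ i ∧ t ≠ j := by
  have hc : (({i, j} : Finset (Fin ν))ᶜ).card = ν - 2 := by
    rw [Finset.card_compl, Finset.card_pair hij, Fintype.card_fin]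
  refine ⟨(Finset.orderEmbOfFin _ hc).toEmbedding, fun t => ?_⟩
  have := Finset.range_orderEmbOfFin _ hc
  simp only [RelEmbedding.coe_toEmbedding, this]
  simp [and_comm]

/-- A vector killed by `M` with two distinct vanishing coordinates is zero. -/
theorem FullRankType.eq_zero_of_mulVec_eq_zero (hM : FullRankType ν M) {i j : Fin ν}
    (hij : i ≠ j) {p : Fin ν → ℂ} (hp : M.mulVec p = 0) (hi : p i = 0) (hj : p j = 0) :
    p = 0 := by
  obtain ⟨g, hg⟩ := exists_embedding_range_eq_compl_pair hij
  have hsub : (M.submatrix id g).mulVec (p ∘ g) = 0 := by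
    rw [← hp]
    ext r
    simp only [Matrix.mulVec, dotProduct, Matrix.submatrix_apply, id_eq, Function.comp_apply]
    rw [← Finset.sum_map Finset.univ g fun t => M r t * p t]
    refine Finset.sum_subset (Finset.subset_univ _) fun t _ ht => ?_
    have : t = i ∨ t = j := by
      by_contra! h
      obtain ⟨a, rfl⟩ := (hg t).2 h
      exact ht (Finset.mem_map_of_mem g (Finset.mem_univ a))
    rcases this with rfl | rfl <;> simp [hi, hj]
  have h0 := Matrix.eq_zero_of_mulVec_eq_zero (hM g) hsub
  ext t
  by_cases hti : t = i
  · rw [hti, hi]; rfl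
  by_cases htj : t = j
  · rw [htj, hj]; rfl
  obtain ⟨a, rfl⟩ := (hg t).2 ⟨hti, htj⟩
  exact congrFun h0 a

/-- For each `i` there is a vector killed by `M` whose only vanishing coordinate is the `i`-th. -/
theorem FullRankType.exists_mulVec_eq_zero (hν : 2 ≤ ν) (hM : FullRankType ν M) (i : Fin ν) :
    ∃ p : Fin ν → ℂ, M.mulVec p = 0 ∧ p i = 0 ∧ ∀ j, j ≠ i → p j ≠ 0 := by
  have hker := LinearMap.ker_ne_bot_of_finrank_lt
    (f := (Matrix.mulVecLin M).prod (LinearMap.proj i : (Fin ν → ℂ) →ₗ[ℂ] ℂ)) (by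
      simp only [Module.finrank_prod, Module.finrank_fintype_fun_eq_card, Fintype.card_fin,
        Module.finrank_self]
      omega)
  obtain ⟨p, hp, hp0⟩ := Submodule.exists_mem_ne_zero_of_ne_bot hker
  simp only [LinearMap.mem_ker, LinearMap.prod_apply, Function.prod_apply, Prod.mk_eq_zero,
    Matrix.mulVecLin_apply, LinearMap.proj_apply] at hp
  exact ⟨p, hp.1, hp.2, fun j hj h => hp0 (hM.eq_zero_of_mulVec_eq_zero hj.symm hp.1 hp.2 h)⟩

/-- A linear form vanishing at such a vector `p` is a combination of the rows of `M` and the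
`i`-th coordinate. -/
theorem FullRankType.exists_vecMul_add_single (hν : 2 ≤ ν) (hM : FullRankType ν M) {i : Fin ν}
    {p : Fin ν → ℂ} (hp : M.mulVec p = 0) (hi : p i = 0) (hne : ∀ j, j ≠ i → p j ≠ 0)
    {c : Fin ν → ℂ} (hc : c ⬝ᵥ p = 0) :
    ∃ (y : Fin (ν - 2) → ℂ) (z : ℂ), c = Matrix.vecMul y M + Pi.single i z := by
  have : Nontrivial (Fin ν) := Fin.nontrivial_iff_two_le.2 hν
  obtain ⟨j, hj⟩ := exists_ne i
  obtain ⟨g, hg⟩ := exists_embedding_range_eq_compl_pair hj.symm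
  obtain ⟨y, hy⟩ := Matrix.vecMul_surjective_iff_isUnit.2
    ((Matrix.isUnit_iff_isUnit_det _).2 (hM g).isUnit) (c ∘ g)
  set d := c - Matrix.vecMul y M with hd
  have hdt : ∀ t, t ≠ i → t ≠ j → d t = 0 := by
    intro t hti htj
    obtain ⟨a, rfl⟩ := (hg t).2 ⟨hti, htj⟩
    have := congrFun hy a
    simp only [Matrix.vecMul, dotProduct, Matrix.submatrix_apply, id_eq,
      Function.comp_apply] at this
    simp [hd, Matrix.vecMul, dotProduct, this]
  have hdp : d ⬝ᵥ p = 0 := by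
    rw [hd, sub_dotProduct, hc, ← Matrix.dotProduct_mulVec, hp, dotProduct_zero, sub_zero]
  have hdj : d j = 0 := by
    rw [dotProduct, Finset.sum_eq_single j (fun t _ htj => ?_) (by simp)] at hdp
    · exact (mul_eq_zero.1 hdp).resolve_right (hne j hj)
    · by_cases hti : t = i
      · rw [hti, hi, mul_zero]
      · rw [hdt t hti htj, zero_mul]
  refine ⟨y, d i, ?_⟩
  have : d = Pi.single i (d i) := by
    ext t
    by_cases hti : t = i
    · rw [hti, Pi.single_eq_same]
    · rw [Pi.single_eq_of_ne hti]
      by_cases htj : t = j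
      · rw [htj, hdj]
      · exact hdt t hti htj
  rw [← this, hd]
  abel

end LinearAlgebra

section Geometry

variable {ν : ℕ} {M : Matrix (Fin (ν - 2)) (Fin ν) ℂ}

theorem sum_vecMul_mem_IM (y : Fin (ν - 2) → ℂ) :
    ∑ t, C (Matrix.vecMul y M t) * X t ∈ IM M := by
  have : ∑ t, C (Matrix.vecMul y M t) * X t =
      ∑ r, C (y r) * ∑ t, C (M r t) * (X t : MvPolynomial (Fin ν) ℂ) := by
    simp only [Matrix.vecMul, dotProduct, map_sum, map_mul, Finset.sum_mul, Finset.mul_sum]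
    rw [Finset.sum_comm]
    simp only [mul_assoc]
  rw [this]
  exact Ideal.sum_mem _ fun r _ => Ideal.mul_mem_left _ _ (Ideal.subset_span ⟨r, rfl⟩)

theorem IM_le_ker_eval {p : Fin ν → ℂ} (hp : M.mulVec p = 0) :
    IM M ≤ RingHom.ker (eval p) := by
  refine Ideal.span_le.2 ?_
  rintro _ ⟨r, rfl⟩
  have := congrFun hp r
  simpa [RingHom.mem_ker, Matrix.mulVec, dotProduct] using this

/-- Restriction of polynomial functions to the line spanned by `p`. -/
noncomputable def restrictLine (p : Fin ν → ℂ) : MvPolynomial (Fin ν) ℂ →ₐ[ℂ] Polynomial ℂ :=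
  aeval fun j => Polynomial.C (p j) * Polynomial.X

theorem restrictLine_eq_of_isHomogeneous (p : Fin ν → ℂ) {f : MvPolynomial (Fin ν) ℂ} {k : ℕ}
    (hf : f.IsHomogeneous k) :
    restrictLine p f = Polynomial.C (eval p f) * Polynomial.X ^ k := by
  rw [restrictLine, aeval_def, eval₂_eq', eval_eq', map_sum, Finset.sum_mul]
  refine Finset.sum_congr rfl fun d hd => ?_
  have hdeg : ∑ t, d t = k := by
    rw [← hf (mem_support_iff.1 hd), ← Finsupp.degree_eq_sum]
    simp [Finsupp.degree_eq_weight_one]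
    rfl
  simp only [mul_pow, Finset.prod_mul_distrib, Finset.prod_pow_eq_pow_sum, hdeg, map_mul,
    map_prod, map_pow, mul_assoc]
  rfl

theorem IM_le_ker_restrictLine {p : Fin ν → ℂ} (hp : M.mulVec p = 0) :
    IM M ≤ RingHom.ker (restrictLine p) := by
  refine Ideal.span_le.2 ?_
  rintro _ ⟨r, rfl⟩
  have := congrFun hp r
  simp only [Matrix.mulVec, dotProduct, Pi.zero_apply] at this
  simp only [SetLike.mem_coe, RingHom.mem_ker, map_sum, map_mul, restrictLine, aeval_X,
    ← mul_assoc, ← Finset.sum_mul, algHom_C, Polynomial.algebraMap_eq]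
  simp only [← map_mul, ← map_sum, this, map_zero, zero_mul]

/-- The ideal of the line spanned by `p` is generated by the linear forms vanishing on it. -/
theorem FullRankType.ker_restrictLine_le (hν : 2 ≤ ν) (hM : FullRankType ν M) {i : Fin ν}
    {p : Fin ν → ℂ} (hp : M.mulVec p = 0) (hi : p i = 0) (hne : ∀ j, j ≠ i → p j ≠ 0) :
    RingHom.ker (restrictLine p) ≤ IM M ⊔ Ideal.span {X i} := by
  set Q := IM M ⊔ Ideal.span {X i} with hQ
  have : Nontrivial (Fin ν) := Fin.nontrivial_iff_two_le.2 hν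
  obtain ⟨j, hj⟩ := exists_ne i
  let σ : Polynomial ℂ →ₐ[ℂ] MvPolynomial (Fin ν) ℂ := Polynomial.aeval (C (p j)⁻¹ * X j)
  have hX : ∀ t, (X t : MvPolynomial (Fin ν) ℂ) - C (p t * (p j)⁻¹) * X j ∈ Q := by
    intro t
    obtain ⟨y, z, hyz⟩ := hM.exists_vecMul_add_single hν hp hi hne
      (c := Pi.single t 1 - Pi.single j (p t * (p j)⁻¹)) (by
        simp [sub_dotProduct, hne j hj])
    have key : (X t : MvPolynomial (Fin ν) ℂ) - C (p t * (p j)⁻¹) * X j =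
        ∑ s, C (Matrix.vecMul y M s) * X s + C z * X i := by
      have h1 : ∀ (a : Fin ν) (w : ℂ), ∑ s, C ((Pi.single a w : Fin ν → ℂ) s) * X s =
          C w * (X a : MvPolynomial (Fin ν) ℂ) := by
        intro a w
        rw [Finset.sum_eq_single a (fun s _ hs => by simp [Pi.single_eq_of_ne hs]) (by simp)]
        simp
      calc _ = ∑ s, C ((Pi.single t 1 - Pi.single j (p t * (p j)⁻¹) : Fin ν → ℂ) s) * X s := by
            simp only [Pi.sub_apply, map_sub, sub_mul, Finset.sum_sub_distrib, h1, map_one,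
              one_mul]
        _ = _ := by
            rw [hyz]
            simp only [Pi.add_apply, map_add, add_mul, Finset.sum_add_distrib, h1]
    rw [key]
    exact add_mem (Ideal.mem_sup_left (sum_vecMul_mem_IM y))
      (Ideal.mem_sup_right (Ideal.mul_mem_left _ _ (Ideal.mem_span_singleton_self _)))
  have hcomp : ((Ideal.Quotient.mkₐ ℂ Q).comp σ).comp (restrictLine p) =
      Ideal.Quotient.mkₐ ℂ Q := by
    refine algHom_ext fun t => ?_
    simp only [AlgHom.comp_apply, restrictLine, aeval_X]
    refine (Ideal.Quotient.eq.2 ?_).symm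
    convert hX t using 2
    simp [σ, mul_assoc, algebraMap_eq]
  intro f hf
  rw [RingHom.mem_ker] at hf
  have := DFunLike.congr_fun hcomp f
  simp only [AlgHom.comp_apply] at this
  rw [show restrictLine p f = 0 from hf, map_zero, map_zero] at this
  exact Ideal.Quotient.eq_zero_iff_mem.1 this.symm

variable {P : Fin ν → Fin ν → ℂ}

/-- A polynomial vanishing on the lines spanned by `P i`, `i ∈ U`, lies in the ideal generated by
the forms of `M` and the product of the variables in `U`. -/
theorem FullRankType.mem_of_restrictLine_eq_zero (hν : 2 ≤ ν) (hM : FullRankType ν M)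
    (hP : ∀ i, M.mulVec (P i) = 0 ∧ P i i = 0 ∧ ∀ j, j ≠ i → P i j ≠ 0) (U : Finset (Fin ν))
    {f : MvPolynomial (Fin ν) ℂ} (hf : ∀ i ∈ U, restrictLine (P i) f = 0) :
    f ∈ IM M ⊔ Ideal.span {∏ i ∈ U, X i} := by
  induction U using Finset.induction_on with
  | empty => simp
  | insert i U hiU ih =>
    obtain ⟨g, hg, u, hu, rfl⟩ := Submodule.mem_sup.1
      (ih fun j hj => hf j (Finset.mem_insert_of_mem hj))
    obtain ⟨h, rfl⟩ := Ideal.mem_span_singleton'.1 hu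
    have h0 := hf i (Finset.mem_insert_self _ _)
    rw [map_add, show restrictLine (P i) g = 0 from IM_le_ker_restrictLine (hP i).1 hg,
      zero_add, map_mul, map_prod] at h0
    have hprod : ∏ j ∈ U, restrictLine (P i) (X j) ≠ 0 := by
      refine Finset.prod_ne_zero_iff.2 fun j hj => ?_
      have : j ≠ i := fun h => hiU (h ▸ hj)
      simp [restrictLine, (hP i).2.2 j this]
    obtain ⟨g', hg', u', hu', rfl⟩ := Submodule.mem_sup.1
      (hM.ker_restrictLine_le hν (hP i).1 (hP i).2.1 (hP i).2.2
        ((mul_eq_zero.1 h0).resolve_right hprod))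
    obtain ⟨h', rfl⟩ := Ideal.mem_span_singleton'.1 hu'
    rw [add_mul, ← add_assoc, Finset.prod_insert hiU]
    refine add_mem (Ideal.mem_sup_left (add_mem hg (Ideal.mul_mem_right _ _ hg')))
      (Ideal.mem_sup_right (Ideal.mem_span_singleton'.2 ⟨h', by ring⟩))

/-- The Hilbert function of `A/(J + I_M)` in degree `k ≥ #U`, for an ideal `J` lying in `(a_i)` for
`i ∈ S` and containing the product over `U` and the products over `U \ {i}` for `i ∈ U \ S`. -/
theorem FullRankType.hdim_add_IM (hν : 2 ≤ ν) (hM : FullRankType ν M)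
    {J : Ideal (MvPolynomial (Fin ν) ℂ)} {S U : Finset (Fin ν)} (hSU : S ⊆ U) {k : ℕ}
    (hk : U.card ≤ k) (hJS : ∀ i ∈ S, J ≤ Ideal.span {X i}) (hJU : ∏ i ∈ U, X i ∈ J)
    (hJ : ∀ i ∈ U, i ∉ S → ∏ j ∈ U.erase i, X j ∈ J) :
    hdim (J + IM M) k = S.card := by
  have : Nontrivial (Fin ν) := Fin.nontrivial_iff_two_le.2 hν
  choose P hP using fun i => hM.exists_mulVec_eq_zero hν i
  choose τ hτ using fun i : Fin ν => exists_ne i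
  let q : Fin ν → MvPolynomial (Fin ν) ℂ := fun i =>
    (∏ j ∈ U.erase i, X j) * X (τ i) ^ (k + 1 - U.card)
  have hqhom : ∀ i ∈ U, (q i).IsHomogeneous k := by
    intro i hi
    have h1 : (∏ j ∈ U.erase i, (X j : MvPolynomial (Fin ν) ℂ)).IsHomogeneous
        (∑ _j ∈ U.erase i, 1) := IsHomogeneous.prod _ _ _ fun j _ => isHomogeneous_X ℂ j
    have h2 := h1.mul ((isHomogeneous_X ℂ (τ i)).pow (k + 1 - U.card))
    convert h2 using 1
    have := Finset.card_pos.2 ⟨i, hi⟩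
    simp only [Finset.sum_const, Finset.card_erase_of_mem hi, smul_eq_mul, mul_one, one_mul]
    omega
  have hqne : ∀ i, eval (P i) (q i) ≠ 0 := by
    intro i
    simp only [q, map_mul, map_prod, map_pow, eval_X]
    exact mul_ne_zero (Finset.prod_ne_zero_iff.2 fun j hj =>
      (hP i).2.2 j (Finset.ne_of_mem_erase hj)) (pow_ne_zero _ ((hP i).2.2 _ (hτ i)))
  have hqzero : ∀ i, ∀ j ∈ U, j ≠ i → eval (P j) (q i) = 0 := by
    intro i j hj hji
    simp only [q, map_mul, map_prod, map_pow, eval_X]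
    rw [Finset.prod_eq_zero (Finset.mem_erase.2 ⟨hji, hj⟩) (hP j).2.1, zero_mul]
  have hqJ : ∀ i ∈ U, i ∉ S → q i ∈ J := fun i hi hiS => Ideal.mul_mem_right _ _ (hJ i hi hiS)
  have hqdiv : ∀ (i : Fin ν) (w : ℂ), eval (P i) (C (w / eval (P i) (q i)) * q i) = w := by
    intro i w
    rw [map_mul, eval_C, div_mul_cancel₀ _ (hqne i)]
  have hle : ∀ i ∈ S, J + IM M ≤ RingHom.ker (eval (P i)) := by
    intro i hi
    refine sup_le ((hJS i hi).trans ?_) (IM_le_ker_eval (hP i).1)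
    rw [Ideal.span_singleton_le_iff_mem, RingHom.mem_ker, eval_X]
    exact (hP i).2.1
  let H := homogeneousSubmodule (Fin ν) ℂ k
  have : Module.Finite ℂ H := Module.Finite.iff_fg.2 (homogeneousSubmodule_fg _ _ k)
  let φ : H →ₗ[ℂ] (S → ℂ) :=
    LinearMap.pi fun i => (aeval (P i) : _ →ₐ[ℂ] ℂ).toLinearMap ∘ₗ H.subtype
  have hφ : ∀ (f : H) (i : S), φ f i = eval (P i) f.1 := fun f i => by
    simp [φ, aeval_eq_eval]
  have hsurj : LinearMap.range φ = ⊤ := by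
    rw [LinearMap.range_eq_top]
    intro w
    have hmem : ∑ i : S, C (w i / eval (P i) (q i)) * q i ∈ H :=
      Submodule.sum_mem _ fun i _ => by
        rw [← smul_eq_C_mul]
        exact Submodule.smul_mem _ _ (hqhom i (hSU i.2))
    refine ⟨⟨_, hmem⟩, funext fun j => ?_⟩
    rw [hφ, map_sum, Finset.sum_eq_single j (fun i _ hij => ?_) (by simp), hqdiv]
    rw [map_mul, hqzero i j (hSU j.2) (fun h => hij (Subtype.ext h.symm)), mul_zero]
  have hker : (LinearMap.ker φ).map H.subtype =
      Submodule.restrictScalars ℂ (J + IM M) ⊓ H := by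
    ext f
    constructor
    · rintro ⟨⟨f, hf⟩, hfk, rfl⟩
      refine ⟨?_, hf⟩
      have hfS : ∀ i ∈ S, eval (P i) f = 0 := fun i hi => by
        have := congrFun (LinearMap.mem_ker.1 hfk) ⟨i, hi⟩
        rwa [hφ] at this
      set r := ∑ i ∈ U \ S, C (eval (P i) f / eval (P i) (q i)) * q i with hr
      have hrJ : r ∈ J := Ideal.sum_mem _ fun i hi =>
        Ideal.mul_mem_left _ _ (hqJ i (Finset.mem_sdiff.1 hi).1 (Finset.mem_sdiff.1 hi).2)
      have hrH : r ∈ H := Submodule.sum_mem _ fun i hi => by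
        rw [← smul_eq_C_mul]
        exact Submodule.smul_mem _ _ (hqhom i (Finset.mem_sdiff.1 hi).1)
      have hev : ∀ j ∈ U, eval (P j) (f - r) = 0 := by
        intro j hj
        rw [map_sub, hr, map_sum, sub_eq_zero]
        have hz : ∀ i, i ≠ j → eval (P j) (C (eval (P i) f / eval (P i) (q i)) * q i) = 0 :=
          fun i hij => by rw [map_mul, hqzero i j hj hij.symm, mul_zero]
        by_cases hjS : j ∈ S
        · rw [hfS j hjS, Finset.sum_eq_zero]
          intro i hi
          exact hz i fun h => (Finset.mem_sdiff.1 hi).2 (h ▸ hjS)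
        · rw [Finset.sum_eq_single j (fun i _ hij => hz i hij)
            (fun h => absurd (Finset.mem_sdiff.2 ⟨hj, hjS⟩) h), hqdiv]
      have hmem := hM.mem_of_restrictLine_eq_zero hν hP U (f := f - r) fun j hj => by
        rw [restrictLine_eq_of_isHomogeneous _ (Submodule.sub_mem _ hf hrH : f - r ∈ H),
          hev j hj, map_zero, zero_mul]
      have hsub : f - r ∈ J + IM M :=
        (sup_le le_sup_right (((Ideal.span_singleton_le_iff_mem _).2 hJU).trans le_sup_left) :
          IM M ⊔ Ideal.span {∏ i ∈ U, X i} ≤ J ⊔ IM M) hmem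
      have := add_mem hsub (Ideal.mem_sup_left hrJ : r ∈ J ⊔ IM M)
      rwa [sub_add_cancel] at this
    · rintro ⟨hfK, hfH⟩
      refine ⟨⟨f, hfH⟩, LinearMap.mem_ker.2 (funext fun i => ?_), rfl⟩
      rw [hφ]
      exact hle i i.2 hfK
  have hrank := LinearMap.finrank_range_add_finrank_ker φ
  rw [hsurj, finrank_top, Module.finrank_fintype_fun_eq_card, Fintype.card_coe] at hrank
  rw [hdim, ← hker, Submodule.finrank_map_subtype_eq]
  change Module.finrank ℂ H - _ = _
  omega

end Geometry

section Arithmetic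

theorem epsQ_eq_floor {ν : ℕ} (α β : Fin ν → ℤ) (i : Fin ν) (l₁ l₂ : ℤ) :
    epsQ ν α β i l₁ l₂ = ((⌊(((l₁ + l₂) * β i : ℤ) : ℚ) / α i⌋ - ⌊((l₁ * β i : ℤ) : ℚ) / α i⌋
      - ⌊((l₂ * β i : ℤ) : ℚ) / α i⌋ : ℤ) : ℚ) := by
  simp only [epsQ, Int.fract]
  push_cast
  ring

theorem floor_mul_div_nonneg {l b a : ℤ} (hl : 0 ≤ l) (hb : 0 ≤ b) (ha : 0 ≤ a) :
    0 ≤ ⌊((l * b : ℤ) : ℚ) / a⌋ :=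
  Int.floor_nonneg.2 (div_nonneg (by exact_mod_cast mul_nonneg hl hb) (by exact_mod_cast ha))

theorem ceil_mul_div_eq {l w a : ℤ} (ha : 0 < a) :
    ⌈((l * w : ℤ) : ℚ) / a⌉ = l - ⌊((l * (a - w) : ℤ) : ℚ) / a⌋ := by
  have ha' : (a : ℚ) ≠ 0 := by exact_mod_cast ha.ne'
  have : ((l * (a - w) : ℤ) : ℚ) / a = l - ((l * w : ℤ) : ℚ) / a := by
    push_cast
    field_simp
  rw [this, sub_eq_add_neg (l : ℚ), Int.floor_intCast_add, Int.floor_neg]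
  ring

theorem sum_floor_le_sVal {ν : ℕ} {b0 : ℤ} {α ω : Fin ν → ℤ} (hα : ∀ i, 0 < α i)
    (hb0 : (ν : ℤ) ≤ b0) {l : ℤ} (hl : 0 ≤ l) :
    ∑ i, ⌊((l * (α i - ω i) : ℤ) : ℚ) / α i⌋ ≤ sVal ν b0 α ω l := by
  simp only [sVal, fun i => ceil_mul_div_eq (l := l) (w := ω i) (hα i), Finset.sum_sub_distrib,
    Finset.sum_const, Finset.card_univ, Fintype.card_fin, nsmul_eq_mul]
  nlinarith [mul_le_mul_of_nonneg_left hb0 hl]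

end Arithmetic

theorem prod_X_pow_ite {ν : ℕ} (p : Fin ν → Prop) [DecidablePred p] :
    ∏ i, (X i : MvPolynomial (Fin ν) ℂ) ^ (if p i then 1 else 0) =
      ∏ i ∈ Finset.univ.filter p, X i := by
  rw [Finset.prod_filter]
  exact Finset.prod_congr rfl fun i _ => by split_ifs <;> simp

/-- Assume `b₀ ≥ ν` and let `M` be of full rank type. Then for every integer `l ≥ 2`,
`dim_ℂ (A/(J(l) + I_M))_{s_l}` equals the number of indices `i` such that
`ε_{i,(j,l−j)} = 1` for every integer `j` with `1 ≤ j ≤ l−1`. -/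
theorem stmt14 (ν : ℕ) (hν : 3 ≤ ν) (b0 : ℤ) (α ω : Fin ν → ℤ)
    (hω : ∀ i, 0 < ω i) (hωα : ∀ i, ω i < α i) (hcop : ∀ i, Int.gcd (α i) (ω i) = 1)
    (e : ℚ) (he : e = -(b0 : ℚ) + ∑ i, (ω i : ℚ) / (α i : ℚ)) (hneg : e < 0)
    (β : Fin ν → ℤ) (hβ : ∀ i, β i = α i - ω i)
    (hb0 : (ν : ℤ) ≤ b0)
    (M : Matrix (Fin (ν - 2)) (Fin ν) ℂ) (hM : FullRankType ν M)
    (l : ℤ) (hl : 2 ≤ l) :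
    hdim (Jl ν b0 α ω β l + IM M) (sVal ν b0 α ω l).toNat =
      Set.ncard {i : Fin ν | ∀ j : ℤ, 1 ≤ j → j ≤ l - 1 → epsQ ν α β i j (l - j) = 1} := by
  classical
  have hα : ∀ i, 0 < α i := fun i => (hω i).trans (hωα i)
  have hβ0 : ∀ i, 0 ≤ β i := fun i => by rw [hβ]; linarith [hωα i]
  have hfl : ∀ i (j : ℤ), 0 ≤ j → 0 ≤ ⌊((j * β i : ℤ) : ℚ) / α i⌋ := fun i j hj =>
    floor_mul_div_nonneg hj (hβ0 i) (hα i).le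
  have hsum : ∀ j : ℤ, 0 ≤ j → ∑ i, ⌊((j * β i : ℤ) : ℚ) / α i⌋ ≤ sVal ν b0 α ω j := by
    intro j hj
    simpa only [hβ] using sum_floor_le_sVal (ω := ω) hα hb0 hj
  have hs : ∀ j : ℤ, 0 ≤ j → 0 ≤ sVal ν b0 α ω j := fun j hj =>
    (Finset.sum_nonneg fun i _ => hfl i j hj).trans (hsum j hj)
  set S : Finset (Fin ν) :=
    Finset.univ.filter fun i => ∀ j : ℤ, 1 ≤ j → j ≤ l - 1 → epsQ ν α β i j (l - j) = 1 with hS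
  set U : Finset (Fin ν) := Finset.univ.filter fun i => 1 ≤ ⌊((l * β i : ℤ) : ℚ) / α i⌋ with hU
  have hTU : ∀ i (j : ℤ), 1 ≤ j → j ≤ l - 1 → epsQ ν α β i j (l - j) = 1 → i ∈ U := by
    intro i j h1 h2 h
    rw [epsQ_eq_floor, add_sub_cancel] at h
    rw [Int.cast_eq_one] at h
    have := hfl i j (by lia)
    have := hfl i (l - j) (by lia)
    rw [hU, Finset.mem_filter]
    exact ⟨Finset.mem_univ _, by lia⟩
  have hmono : ∀ j : ℤ, 1 ≤ j → j ≤ l - 1 →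
      ∏ i ∈ Finset.univ.filter (fun i => epsQ ν α β i j (l - j) = 1), X i ∈ Jl ν b0 α ω β l := by
    intro j h1 h2
    refine Ideal.subset_span ⟨j, l - j, h1, by lia, by lia, hs _ (by lia), hs _ (by lia), ?_⟩
    rw [prod_X_pow_ite]
  have hcard : U.card ≤ (sVal ν b0 α ω l).toNat := by
    have : (U.card : ℤ) ≤ ∑ i, ⌊((l * β i : ℤ) : ℚ) / α i⌋ := by
      rw [hU, Finset.card_filter]
      rw [Nat.cast_sum]
      refine Finset.sum_le_sum fun i _ => ?_
      split_ifs with h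
      · exact h
      · exact hfl i l (by lia)
    have := hsum l (by lia)
    lia
  have hset : {i : Fin ν | ∀ j : ℤ, 1 ≤ j → j ≤ l - 1 → epsQ ν α β i j (l - j) = 1} = S := by
    ext i
    simp [hS]
  rw [hset, Set.ncard_coe_finset]
  refine hM.hdim_add_IM (U := U) (by lia) ?_ hcard ?_ ?_ ?_
  · intro i hi
    exact hTU i 1 le_rfl (by lia) ((Finset.mem_filter.1 hi).2 1 le_rfl (by lia))
  · intro i hi
    refine Ideal.span_le.2 ?_
    rintro _ ⟨l₁, l₂, h1, h2, rfl, -, -, rfl⟩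
    have h := (Finset.mem_filter.1 hi).2 l₁ h1 (by lia)
    rw [add_sub_cancel_left] at h
    rw [prod_X_pow_ite]
    exact Ideal.mem_span_singleton.2 (Finset.dvd_prod_of_mem _ (by simpa using h))
  · refine Ideal.mem_of_dvd _ (Finset.prod_dvd_prod_of_subset _ _ _ fun i hi => ?_)
      (hmono 1 le_rfl (by lia))
    exact hTU i 1 le_rfl (by lia) (Finset.mem_filter.1 hi).2
  · intro i _ hiS
    have : ∃ j : ℤ, 1 ≤ j ∧ j ≤ l - 1 ∧ epsQ ν α β i j (l - j) ≠ 1 := by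
      by_contra! h
      exact hiS (Finset.mem_filter.2 ⟨Finset.mem_univ _, h⟩)
    obtain ⟨j, h1, h2, h⟩ := this
    refine Ideal.mem_of_dvd _ (Finset.prod_dvd_prod_of_subset _ _ _ fun t ht => ?_)
      (hmono j h1 h2)
    have ht := (Finset.mem_filter.1 ht).2
    exact Finset.mem_erase.2 ⟨fun hti => h (hti ▸ ht), hTU t j h1 h2 ht⟩
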